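/- Let k be a field, let R1 and R2 be commutative k-algebras, let N1 be a finitely presented R1-module and N2 a finitely presented R2-module, and let M1 be an R1-module and M2 an R2-module. Then the natural map η: Hom_{R1}(N1, M1) ⊗_k Hom_{R2}(N2, M2) → Hom_{R1 ⊗_k R2}(N1 ⊗_k N2, M1 ⊗_k M2), sending f ⊗ g to the map n1 ⊗ n2 ↦ f(n1) ⊗ g(n2), is an isomorphism of k-vector spaces. -/

import Mathlib

open TensorProduct CategoryTheory

section TensorModule

variable (k : Type) [CommRing k] (R1 R2 : Type) [CommRing R1] [CommRing R2]
  [Algebra k R1] [Algebra k R2]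
variable (M1 M2 : Type) [AddCommGroup M1] [Module k M1] [Module R1 M1] [IsScalarTower k R1 M1]
  [AddCommGroup M2] [Module k M2] [Module R2 M2] [IsScalarTower k R2 M2]

/-- The action of `R2` on `M1 ⊗[k] M2` through the right factor, as an algebra morphism
to endomorphisms. -/
noncomputable def rightSMul : R2 →ₐ[k] Module.End k (M1 ⊗[k] M2) :=
  ((Module.endTensorEndAlgHom (R := k) (S := k) (A := k) (M := M1) (N := M2)).comp
      (Algebra.TensorProduct.includeRight (R := k) (A := Module.End k M1))).comp
    (Algebra.lsmul k k M2 (A := R2))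

/-- The `R2`-module structure on `M1 ⊗[k] M2` via the right factor. -/
noncomputable def rightModule : Module R2 (M1 ⊗[k] M2) :=
  Module.compHom _ (rightSMul k R2 M1 M2).toRingHom

/-- The `R1 ⊗[k] R2`-module structure on `M1 ⊗[k] M2`, characterized by
`(r1 ⊗ r2) • (m1 ⊗ m2) = (r1 • m1) ⊗ (r2 • m2)`; see `tensorModule_smul_tmul`. -/
noncomputable instance (priority := 10) tensorModule :
    Module (R1 ⊗[k] R2) (M1 ⊗[k] M2) :=
  letI m2 : Module R2 (M1 ⊗[k] M2) := rightModule k R2 M1 M2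
  haveI t2 : IsScalarTower k R2 (M1 ⊗[k] M2) := by
    refine IsScalarTower.of_algebraMap_smul (fun r x => ?_)
    show (rightSMul k R2 M1 M2) (algebraMap k R2 r) x = r • x
    rw [AlgHom.commutes]
    simp [Module.algebraMap_end_apply]
  haveI sc : SMulCommClass R1 R2 (M1 ⊗[k] M2) := by
    constructor
    intro r1 r2 x
    show r1 • (rightSMul k R2 M1 M2 r2) x = (rightSMul k R2 M1 M2 r2) (r1 • x)
    induction x using TensorProduct.induction_on with
    | zero => simp
    | tmul m n =>
        have h1 : (rightSMul k R2 M1 M2 r2) (m ⊗ₜ[k] n) = m ⊗ₜ[k] (r2 • n) := rfl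
        have h2 : (rightSMul k R2 M1 M2 r2) ((r1 • m) ⊗ₜ[k] n) = (r1 • m) ⊗ₜ[k] (r2 • n) := rfl
        rw [h1, smul_tmul', smul_tmul', h2]
    | add x y hx hy =>
        calc r1 • (rightSMul k R2 M1 M2 r2) (x + y)
            = r1 • ((rightSMul k R2 M1 M2 r2) x + (rightSMul k R2 M1 M2 r2) y) := by
              rw [(rightSMul k R2 M1 M2 r2).map_add]
          _ = r1 • (rightSMul k R2 M1 M2 r2) x + r1 • (rightSMul k R2 M1 M2 r2) y :=
              smul_add _ _ _
          _ = (rightSMul k R2 M1 M2 r2) (r1 • x) + (rightSMul k R2 M1 M2 r2) (r1 • y) := by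
              rw [hx, hy]
          _ = (rightSMul k R2 M1 M2 r2) (r1 • x + r1 • y) :=
              ((rightSMul k R2 M1 M2 r2).map_add _ _).symm
          _ = (rightSMul k R2 M1 M2 r2) (r1 • (x + y)) := by rw [smul_add]
  TensorProduct.Algebra.module

/-- The defining property of the `R1 ⊗[k] R2`-module structure on `M1 ⊗[k] M2`. -/
lemma tensorModule_smul_tmul (r1 : R1) (r2 : R2) (m : M1) (n : M2) :
    (r1 ⊗ₜ[k] r2 : R1 ⊗[k] R2) • (m ⊗ₜ[k] n : M1 ⊗[k] M2) = (r1 • m) ⊗ₜ[k] (r2 • n) := rfl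

end TensorModule


section Eta

open TensorProduct

variable (k : Type) [CommRing k] (R1 R2 : Type) [CommRing R1] [CommRing R2]
  [Algebra k R1] [Algebra k R2]
variable {N1 M1 N2 M2 : Type}
  [AddCommGroup N1] [Module k N1] [Module R1 N1] [IsScalarTower k R1 N1]
  [AddCommGroup M1] [Module k M1] [Module R1 M1] [IsScalarTower k R1 M1]
  [AddCommGroup N2] [Module k N2] [Module R2 N2] [IsScalarTower k R2 N2]
  [AddCommGroup M2] [Module k M2] [Module R2 M2] [IsScalarTower k R2 M2]

instance (priority := 10) tensorModule_isScalarTower :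
    IsScalarTower k (R1 ⊗[k] R2) (M1 ⊗[k] M2) := by
  refine IsScalarTower.of_algebraMap_smul (fun c x => ?_)
  rw [Algebra.TensorProduct.algebraMap_apply]
  induction x using TensorProduct.induction_on with
  | zero => rw [smul_zero, smul_zero]
  | tmul m n =>
      rw [tensorModule_smul_tmul, algebraMap_smul, one_smul, smul_tmul']
  | add x y hx hy => rw [smul_add, hx, hy, smul_add]

/-- For `R1`-linear `f : N1 → M1` and `R2`-linear `g : N2 → M2`, the induced
`R1 ⊗[k] R2`-linear map `N1 ⊗[k] N2 → M1 ⊗[k] M2`, `n1 ⊗ n2 ↦ f n1 ⊗ g n2`. -/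
noncomputable def mapS (f : N1 →ₗ[R1] M1) (g : N2 →ₗ[R2] M2) :
    (N1 ⊗[k] N2) →ₗ[R1 ⊗[k] R2] (M1 ⊗[k] M2) where
  toFun := TensorProduct.map (f.restrictScalars k) (g.restrictScalars k)
  map_add' x y := map_add _ x y
  map_smul' s x := by
    simp only [RingHom.id_apply]
    induction s using TensorProduct.induction_on with
    | zero => rw [zero_smul, map_zero, zero_smul]
    | tmul r1 r2 =>
        induction x using TensorProduct.induction_on with
        | zero => rw [smul_zero, map_zero, smul_zero]
        | tmul m n => simp [tensorModule_smul_tmul, map_smul]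
        | add x y hx hy => rw [smul_add, map_add, hx, hy, map_add, smul_add]
    | add s t hs ht => rw [add_smul, map_add, hs, ht, add_smul]

@[simp] lemma mapS_tmul (f : N1 →ₗ[R1] M1) (g : N2 →ₗ[R2] M2) (n1 : N1) (n2 : N2) :
    mapS k R1 R2 f g (n1 ⊗ₜ[k] n2) = f n1 ⊗ₜ[k] g n2 := rfl

set_option maxHeartbeats 2000000 in
/-- The natural map
`Hom_{R1}(N1,M1) ⊗[k] Hom_{R2}(N2,M2) → Hom_{R1 ⊗[k] R2}(N1 ⊗[k] N2, M1 ⊗[k] M2)`,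
sending `f ⊗ g` to the map `n1 ⊗ n2 ↦ f n1 ⊗ g n2`. -/
noncomputable def etaMap :
    ((N1 →ₗ[R1] M1) ⊗[k] (N2 →ₗ[R2] M2)) →ₗ[k]
      ((N1 ⊗[k] N2) →ₗ[R1 ⊗[k] R2] (M1 ⊗[k] M2)) :=
  TensorProduct.lift
    { toFun := fun f =>
        { toFun := fun g => mapS k R1 R2 f g
          map_add' := fun g g' => by
            apply LinearMap.ext; intro x
            have h : (g + g').restrictScalars k
                = g.restrictScalars k + g'.restrictScalars k := rfl
            show TensorProduct.map _ ((g + g').restrictScalars k) x = _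
            rw [h, TensorProduct.map_add_right]
            rfl
          map_smul' := fun c g => by
            apply LinearMap.ext; intro x
            have h : (c • g).restrictScalars k = c • g.restrictScalars k := rfl
            show TensorProduct.map _ ((c • g).restrictScalars k) x = _
            rw [h, TensorProduct.map_smul_right]
            rfl }
      map_add' := fun f f' => by
        apply LinearMap.ext; intro g
        apply LinearMap.ext; intro x
        have h : (f + f').restrictScalars k
            = f.restrictScalars k + f'.restrictScalars k := rfl
        show TensorProduct.map ((f + f').restrictScalars k) _ x = _
        rw [h, TensorProduct.map_add_left]
        rfl
      map_smul' := fun c f => by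
        apply LinearMap.ext; intro g
        apply LinearMap.ext; intro x
        have h : (c • f).restrictScalars k = c • f.restrictScalars k := rfl
        show TensorProduct.map ((c • f).restrictScalars k) _ x = _
        rw [h, TensorProduct.map_smul_left]
        rfl }

@[simp] lemma etaMap_tmul (f : N1 →ₗ[R1] M1) (g : N2 →ₗ[R2] M2) :
    etaMap k R1 R2 (f ⊗ₜ[k] g) = mapS k R1 R2 f g := rfl

end Eta


section Presentation

variable (k : Type*) {R N M ι κ : Type*} [CommRing k] [CommRing R] [Algebra k R]
  [AddCommGroup N] [Module R N]
  [AddCommGroup M] [Module k M] [Module R M] [IsScalarTower k R M]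

/-- Evaluation of linear maps at a family of elements. -/
def evalFamily (M : Type*) [AddCommGroup M] [Module k M] [Module R M] [IsScalarTower k R M]
    (e : ι → N) : (N →ₗ[R] M) →ₗ[k] (ι → M) :=
  LinearMap.pi fun i => LinearMap.applyₗ' k (e i)

@[simp] lemma evalFamily_apply (e : ι → N) (f : N →ₗ[R] M) (i : ι) :
    evalFamily k M e f i = f (e i) := rfl

lemma evalFamily_injective {e : ι → N} (he : Submodule.span R (Set.range e) = ⊤) :
    Function.Injective (evalFamily (R := R) k M e) := fun _ _ h =>
  LinearMap.ext_on_range he fun i => congrFun h i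

/-- Multiplication of a vector with entries in a module by a matrix with entries in `R`. -/
def relationMap [Fintype ι] (M : Type*) [AddCommGroup M] [Module k M] [Module R M]
    [IsScalarTower k R M] (a : κ → ι → R) : (ι → M) →ₗ[k] (κ → M) :=
  LinearMap.pi fun l => ∑ i, (Algebra.lsmul k k M (a l i)) ∘ₗ LinearMap.proj i

@[simp] lemma relationMap_apply [Fintype ι] (a : κ → ι → R) (v : ι → M) (l : κ) :
    relationMap k M a v l = ∑ i, a l i • v i := by
  simp [relationMap]

/-- A finitely presented module has finitely many generators and relations, and linear maps
out of it are the families of elements satisfying the relations. -/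
lemma exists_generators_relations (R N : Type*) [CommRing R] [Algebra k R]
    [AddCommGroup N] [Module R N] [Module.FinitePresentation R N]
    (M : Type*) [AddCommGroup M] [Module k M] [Module R M] [IsScalarTower k R M] :
    ∃ (n m : ℕ) (e : Fin n → N) (a : Fin m → Fin n → R),
      Submodule.span R (Set.range e) = ⊤ ∧ (∀ l, ∑ i, a l i • e i = 0) ∧
        Function.Exact (evalFamily (R := R) k M e) (relationMap k M a) := by
  obtain ⟨n, m, f, g, hf, hfg⟩ := Module.FinitePresentation.exists_fin' R N
  have f_eq_sum (v : Fin n → R) : f v = ∑ i, v i • f (Pi.single i 1) := by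
    conv_lhs => rw [pi_eq_sum_univ' v]
    simp
  have hrel (l : Fin m) : ∑ i, g (Pi.single l 1) i • f (Pi.single i 1) = 0 := by
    rw [← f_eq_sum, hfg.apply_apply_eq_zero]
  refine ⟨n, m, fun i => f (Pi.single i 1), fun l => g (Pi.single l 1), ?_, hrel, fun v => ?_⟩
  · refine eq_top_iff.mpr fun x _ => ?_
    obtain ⟨v, rfl⟩ := hf x
    rw [f_eq_sum]
    exact Submodule.sum_mem _ fun i _ => Submodule.smul_mem _ _ (Submodule.subset_span ⟨i, rfl⟩)
  · constructor
    · intro h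
      let F : (Fin n → R) →ₗ[R] M := Fintype.linearCombination R v
      have hFs (i : Fin n) : F (Pi.single i 1) = v i := by
        simp [F]
      have hFg : F ∘ₗ g = 0 := by
        refine LinearMap.pi_ext' fun l => LinearMap.ext_ring ?_
        have := congrFun h l
        simpa [F, Fintype.linearCombination_apply] using this
      have hker : LinearMap.ker f ≤ LinearMap.ker F := fun x hx => by
        obtain ⟨y, rfl⟩ := (hfg x).mp hx
        exact LinearMap.congr_fun hFg y
      refine ⟨(LinearMap.ker f).liftQ F hker ∘ₗ
        (f.quotKerEquivOfSurjective hf).symm.toLinearMap, funext fun i => ?_⟩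
      have : (f.quotKerEquivOfSurjective hf).symm (f (Pi.single i 1)) =
          Submodule.Quotient.mk (Pi.single i 1) := by
        rw [LinearEquiv.symm_apply_eq]
        rfl
      simp [this, hFs]
    · rintro ⟨φ, rfl⟩
      funext l
      have := congrArg φ (hrel l)
      simpa using this

end Presentation

section LinearAlgebra

/-- The tensor product of two kernels is the intersection of the kernels of the tensored maps. -/
lemma mem_range_map_of_exact {k U V W U' V' W' : Type*} [Field k]
    [AddCommGroup U] [Module k U] [AddCommGroup V] [Module k V] [AddCommGroup W] [Module k W]
    [AddCommGroup U'] [Module k U'] [AddCommGroup V'] [Module k V'] [AddCommGroup W'] [Module k W']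
    {f : U →ₗ[k] V} {g : V →ₗ[k] W} {f' : U' →ₗ[k] V'} {g' : V' →ₗ[k] W'}
    (hf : Function.Injective f) (h : Function.Exact f g) (h' : Function.Exact f' g')
    {t : V ⊗[k] V'} (ht : g.rTensor V' t = 0) (ht' : g'.lTensor V t = 0) :
    ∃ w, TensorProduct.map f f' w = t := by
  obtain ⟨u, rfl⟩ := (Module.Flat.rTensor_exact V' h t).mp ht
  have hu : g'.lTensor U u = 0 := by
    apply Module.Flat.rTensor_preserves_injective_linearMap (M := W') f hf
    rw [map_zero, ← ht', ← LinearMap.comp_apply, ← LinearMap.comp_apply,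
      LinearMap.rTensor_comp_lTensor, LinearMap.lTensor_comp_rTensor]
  obtain ⟨w, rfl⟩ := (Module.Flat.lTensor_exact U h' u).mp hu
  refine ⟨w, ?_⟩
  rw [← LinearMap.comp_apply, LinearMap.rTensor_comp_lTensor]

variable {k ι κ V W : Type*} [CommRing k] [Fintype ι] [Fintype κ]
  [AddCommGroup V] [Module k V] [AddCommGroup W] [Module k W]

/-- A tensor of two tuples is determined by its coordinates. -/
lemma pi_tmul_pi_ext {s t : (ι → V) ⊗[k] (κ → W)}
    (h : ∀ i j, TensorProduct.map (LinearMap.proj (R := k) (φ := fun _ : ι => V) i)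
        (LinearMap.proj (R := k) (φ := fun _ : κ => W) j) s =
      TensorProduct.map (LinearMap.proj i) (LinearMap.proj j) t) : s = t := by
  classical
  have key (x : (ι → V) ⊗[k] (κ → W)) :
      x = ∑ i, ∑ j, TensorProduct.map (LinearMap.single k (fun _ : ι => V) i)
        (LinearMap.single k (fun _ : κ => W) j)
        (TensorProduct.map (LinearMap.proj i) (LinearMap.proj j) x) := by
    induction x using TensorProduct.induction_on with
    | zero => simp
    | tmul v w =>
      simp only [TensorProduct.map_tmul, LinearMap.proj_apply, LinearMap.single_apply]
      simp_rw [← TensorProduct.tmul_sum, ← TensorProduct.sum_tmul, Finset.univ_sum_single]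
    | add x y hx hy =>
      simp only [map_add, Finset.sum_add_distrib]
      rw [← hx, ← hy]
  rw [key s, key t]
  simp only [h]

/-- The coordinates of a tensor of two tuples can be prescribed. -/
lemma exists_pi_tmul_pi (x : ι → κ → V ⊗[k] W) :
    ∃ t : (ι → V) ⊗[k] (κ → W), ∀ i j,
      TensorProduct.map (LinearMap.proj i) (LinearMap.proj j) t = x i j := by
  classical
  refine ⟨∑ i, ∑ j, TensorProduct.map (LinearMap.single k (fun _ : ι => V) i)
    (LinearMap.single k (fun _ : κ => W) j) (x i j), fun i j => ?_⟩
  simp only [map_sum, ← LinearMap.comp_apply, ← TensorProduct.map_comp]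
  rw [Finset.sum_eq_single i, Finset.sum_eq_single j]
  · simp [LinearMap.proj_comp_single_same]
  · intro b _ hb
    rw [LinearMap.proj_comp_single_ne k _ _ _ hb.symm]
    simp
  · simp
  · intro b _ hb
    rw [LinearMap.proj_comp_single_ne k _ _ _ hb.symm]
    simp
  · simp

end LinearAlgebra

section Eta

variable {k R1 R2 N1 M1 N2 M2 : Type} [CommRing k] [CommRing R1] [CommRing R2]
  [Algebra k R1] [Algebra k R2]
  [AddCommGroup N1] [Module k N1] [Module R1 N1] [IsScalarTower k R1 N1]
  [AddCommGroup M1] [Module k M1] [Module R1 M1] [IsScalarTower k R1 M1]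
  [AddCommGroup N2] [Module k N2] [Module R2 N2] [IsScalarTower k R2 N2]
  [AddCommGroup M2] [Module k M2] [Module R2 M2] [IsScalarTower k R2 M2]

/-- Linear maps out of `N1 ⊗[k] N2` are determined by their values on tensors of generators. -/
lemma tensorModule_hom_ext {ι κ : Type*} {e : ι → N1} {e' : κ → N2}
    (he : Submodule.span R1 (Set.range e) = ⊤) (he' : Submodule.span R2 (Set.range e') = ⊤)
    {φ ψ : (N1 ⊗[k] N2) →ₗ[R1 ⊗[k] R2] (M1 ⊗[k] M2)}
    (h : ∀ i j, φ (e i ⊗ₜ e' j) = ψ (e i ⊗ₜ e' j)) : φ = ψ := by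
  refine LinearMap.ext fun x => ?_
  induction x using TensorProduct.induction_on with
  | zero => rw [map_zero, map_zero]
  | add x y hx hy => rw [map_add, map_add, hx, hy]
  | tmul x y =>
    have hx : x ∈ Submodule.span R1 (Set.range e) := he ▸ Submodule.mem_top
    have hy : y ∈ Submodule.span R2 (Set.range e') := he' ▸ Submodule.mem_top
    induction hx using Submodule.span_induction with
    | zero => rw [zero_tmul, map_zero, map_zero]
    | add x x' _ _ hx hx' => rw [add_tmul, map_add, map_add, hx, hx']
    | smul r x _ hx =>
      have : (r • x) ⊗ₜ[k] y = (r ⊗ₜ[k] (1 : R2) : R1 ⊗[k] R2) • (x ⊗ₜ[k] y) := by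
        rw [tensorModule_smul_tmul, one_smul]
      rw [this, map_smul, map_smul, hx]
    | mem x hx =>
      obtain ⟨i, rfl⟩ := hx
      induction hy using Submodule.span_induction with
      | zero => rw [tmul_zero, map_zero, map_zero]
      | add y y' _ _ hy hy' => rw [tmul_add, map_add, map_add, hy, hy']
      | smul r y _ hy =>
        have : e i ⊗ₜ[k] (r • y) = ((1 : R1) ⊗ₜ[k] r : R1 ⊗[k] R2) • (e i ⊗ₜ[k] y) := by
          rw [tensorModule_smul_tmul, one_smul]
        rw [this, map_smul, map_smul, hy]
      | mem y hy =>
        obtain ⟨j, rfl⟩ := hy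
        exact h i j

lemma etaMap_apply_tmul {ι κ : Type*} (e : ι → N1) (e' : κ → N2)
    (w : (N1 →ₗ[R1] M1) ⊗[k] (N2 →ₗ[R2] M2)) (i : ι) (j : κ) :
    etaMap k R1 R2 w (e i ⊗ₜ e' j) =
      TensorProduct.map (LinearMap.proj i) (LinearMap.proj j)
        (TensorProduct.map (evalFamily (R := R1) k M1 e) (evalFamily (R := R2) k M2 e') w) := by
  induction w using TensorProduct.induction_on with
  | zero => rw [map_zero, map_zero, map_zero, LinearMap.zero_apply]
  | add x y hx hy => rw [map_add, map_add, map_add, LinearMap.add_apply, hx, hy]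
  | tmul f g => simp

lemma rTensor_relationMap {ι κ κ' : Type*} [Fintype ι] (a : κ → ι → R1) (l : κ) (j : κ')
    (t : (ι → M1) ⊗[k] (κ' → M2)) :
    TensorProduct.map (LinearMap.proj l) (LinearMap.proj j)
      ((relationMap k M1 a).rTensor (κ' → M2) t) =
    ∑ i, (a l i ⊗ₜ[k] (1 : R2) : R1 ⊗[k] R2) •
      TensorProduct.map (LinearMap.proj (R := k) (φ := fun _ : ι => M1) i)
        (LinearMap.proj (R := k) (φ := fun _ : κ' => M2) j) t := by
  induction t using TensorProduct.induction_on with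
  | zero => simp only [map_zero, smul_zero, Finset.sum_const_zero]
  | add x y hx hy => simp only [map_add, smul_add, Finset.sum_add_distrib, hx, hy]
  | tmul v w =>
    simp only [LinearMap.rTensor_tmul, TensorProduct.map_tmul, LinearMap.proj_apply,
      relationMap_apply, tensorModule_smul_tmul, one_smul, TensorProduct.sum_tmul]

lemma lTensor_relationMap {ι κ κ' : Type*} [Fintype ι] (a : κ → ι → R2) (l : κ) (j : κ')
    (t : (κ' → M1) ⊗[k] (ι → M2)) :
    TensorProduct.map (LinearMap.proj j) (LinearMap.proj l)
      ((relationMap k M2 a).lTensor (κ' → M1) t) =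
    ∑ i, ((1 : R1) ⊗ₜ[k] a l i : R1 ⊗[k] R2) •
      TensorProduct.map (LinearMap.proj (R := k) (φ := fun _ : κ' => M1) j)
        (LinearMap.proj (R := k) (φ := fun _ : ι => M2) i) t := by
  induction t using TensorProduct.induction_on with
  | zero => simp only [map_zero, smul_zero, Finset.sum_const_zero]
  | add x y hx hy => simp only [map_add, smul_add, Finset.sum_add_distrib, hx, hy]
  | tmul v w =>
    simp only [LinearMap.lTensor_tmul, TensorProduct.map_tmul, LinearMap.proj_apply,
      relationMap_apply, tensorModule_smul_tmul, one_smul, TensorProduct.tmul_sum]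

end Eta


open TensorProduct in
/-- Let `k` be a field, `R1`, `R2` commutative `k`-algebras, `N1` a finitely presented
`R1`-module, `N2` a finitely presented `R2`-module, `M1` an `R1`-module and `M2` an
`R2`-module.  The natural map
`η : Hom_{R1}(N1,M1) ⊗[k] Hom_{R2}(N2,M2) → Hom_{R1 ⊗ R2}(N1 ⊗ N2, M1 ⊗ M2)`,
`f ⊗ g ↦ (n1 ⊗ n2 ↦ f n1 ⊗ g n2)`, is an isomorphism of `k`-vector spaces. -/
theorem etaMap_bijective
    (k : Type) [Field k] (R1 R2 : Type) [CommRing R1] [CommRing R2]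
    [Algebra k R1] [Algebra k R2]
    (N1 M1 : Type) [AddCommGroup N1] [Module k N1] [Module R1 N1] [IsScalarTower k R1 N1]
    [AddCommGroup M1] [Module k M1] [Module R1 M1] [IsScalarTower k R1 M1]
    (N2 M2 : Type) [AddCommGroup N2] [Module k N2] [Module R2 N2] [IsScalarTower k R2 N2]
    [AddCommGroup M2] [Module k M2] [Module R2 M2] [IsScalarTower k R2 M2]
    [Module.FinitePresentation R1 N1] [Module.FinitePresentation R2 N2] :
    Function.Bijective
      (etaMap k R1 R2 (N1 := N1) (M1 := M1) (N2 := N2) (M2 := M2)) := by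
  obtain ⟨n1, m1, e1, a1, he1, ha1, hex1⟩ := exists_generators_relations k R1 N1 M1
  obtain ⟨n2, m2, e2, a2, he2, ha2, hex2⟩ := exists_generators_relations k R2 N2 M2
  have hinj1 := evalFamily_injective (M := M1) k he1
  have hinj2 := evalFamily_injective (M := M2) k he2
  constructor
  · intro w w' h
    refine TensorProduct.map_injective_of_flat_flat _ _ hinj1 hinj2 (pi_tmul_pi_ext fun i j => ?_)
    rw [← etaMap_apply_tmul, ← etaMap_apply_tmul, h]
  · intro φ
    obtain ⟨t, ht⟩ := exists_pi_tmul_pi fun i j => φ (e1 i ⊗ₜ e2 j)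
    have ht1 : (relationMap k M1 a1).rTensor (Fin n2 → M2) t = 0 := by
      refine pi_tmul_pi_ext fun l j => ?_
      rw [rTensor_relationMap (R2 := R2)]
      simp only [ht, ← map_smul, ← map_sum, tensorModule_smul_tmul, one_smul,
        ← TensorProduct.sum_tmul, ha1, TensorProduct.zero_tmul, map_zero]
    have ht2 : (relationMap k M2 a2).lTensor (Fin n1 → M1) t = 0 := by
      refine pi_tmul_pi_ext fun i l => ?_
      rw [lTensor_relationMap (R1 := R1)]
      simp only [ht, ← map_smul, ← map_sum, tensorModule_smul_tmul, one_smul,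
        ← TensorProduct.tmul_sum, ha2, TensorProduct.tmul_zero, map_zero]
    obtain ⟨w, rfl⟩ := mem_range_map_of_exact hinj1 hex1 hex2 ht1 ht2
    refine ⟨w, tensorModule_hom_ext he1 he2 fun i j => ?_⟩
    rw [etaMap_apply_tmul, ht]
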